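/- For every d ∈ ℕ and every finitely supported f : ℤ^d → ℂ one has ‖ sup_{t ∈ ℕ, 1 ≤ t ≤ d} |𝓕^{−1}(λ_t^2 · f̂)| ‖_{l^2(ℤ^d)} ≤ 2 · ‖f‖_{l^2(ℤ^d)}. -/

import Mathlib

open Finset MeasureTheory
open scoped ENNReal NNReal

noncomputable section

/-- `S_t = {x ∈ {-1,0,1}^d : Σ |x_i| = t}`. -/
def sphereS (d t : ℕ) : Finset (Fin d → ℤ) :=
  (Finset.Icc (fun _ => (-1 : ℤ)) (fun _ => (1 : ℤ))).filter fun y => ∑ i, |y i| = (t : ℤ)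

/-- The discrete Fourier transform of a (finitely supported) `f : ℤ^d → ℂ`:
`f̂(ξ) = Σ_x f(x) e(x·ξ)`, where `e(y) = e^{2πiy}`. -/
def ftrans (d : ℕ) (f : (Fin d → ℤ) → ℂ) (ξ : Fin d → ℝ) : ℂ :=
  ∑ᶠ x : Fin d → ℤ, f x * Complex.exp (2 * (Real.pi : ℂ) * Complex.I * ∑ k, (x k : ℂ) * (ξ k : ℂ))

/-- The inverse Fourier transform `𝓕⁻¹(G)(x) = ∫_{𝕋^d} G(ξ) e(-x·ξ) dξ`,
with `𝕋^d` identified with `[-1/2, 1/2)^d`. -/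
def finv (d : ℕ) (G : (Fin d → ℝ) → ℂ) (x : Fin d → ℤ) : ℂ :=
  ∫ ξ in Set.Icc (fun _ => (-(1 / 2) : ℝ)) (fun _ => ((1 / 2) : ℝ)),
    G ξ * Complex.exp (-(2 * (Real.pi : ℂ) * Complex.I * ∑ k, (x k : ℂ) * (ξ k : ℂ)))

/-- `λ_t²(ξ) = |S_t|⁻¹ (Σ_{x ∈ S_t} (-1)^{Σ x_i}) exp(-(t/d) Σ cos²(π ξ_i))`. -/
def lam2 (d t : ℕ) (ξ : Fin d → ℝ) : ℝ :=
  ((sphereS d t).card : ℝ)⁻¹ * (∑ x ∈ sphereS d t, (-1 : ℝ) ^ (∑ i, x i)) *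
    Real.exp (-((t : ℝ) / d) * ∑ i, Real.cos (Real.pi * ξ i) ^ 2)

lemma norm_sq_sum_pow_mul_le (r : ℝ) (h0 : 0 ≤ r) (h1 : r ≤ 1) (S : ℕ → ℂ) (hS : S 0 = 0)
    (N : ℕ) :
    ‖∑ n ∈ range N, (r : ℂ) ^ n * (S (n + 1) - S n)‖ ^ 2 ≤
      ∑ n ∈ range N, r ^ n * (‖S (n + 1)‖ ^ 2 - ‖S n‖ ^ 2) := by
  have cauchy : ∀ (h s : ℂ) (W w D : ℝ), 0 ≤ W → 0 ≤ w → ‖h‖ ^ 2 ≤ W * D → 0 ≤ D →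
      ‖h + w * s‖ ^ 2 ≤ (W + w) * (D + w * ‖s‖ ^ 2) := by
    intro h s W w D hW hw hh hD
    have h2 : ‖h + w * s‖ ≤ ‖h‖ + w * ‖s‖ := by
      refine (norm_add_le _ _).trans ?_
      rw [norm_mul, Complex.norm_real, Real.norm_of_nonneg hw]
    have h3 : 2 * ‖h‖ * ‖s‖ ≤ D + W * ‖s‖ ^ 2 := by
      have h4 : (2 * ‖h‖ * ‖s‖) ^ 2 ≤ (D + W * ‖s‖ ^ 2) ^ 2 := by
        nlinarith [sq_nonneg (D - W * ‖s‖ ^ 2), mul_le_mul_of_nonneg_right hh (sq_nonneg ‖s‖)]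
      exact (abs_le_of_sq_le_sq' h4 (by positivity)).2
    calc ‖h + w * s‖ ^ 2 ≤ (‖h‖ + w * ‖s‖) ^ 2 := by gcongr
      _ ≤ _ := by nlinarith [mul_le_mul_of_nonneg_left h3 hw]
  have key : ∀ N, 0 ≤ (∑ n ∈ range N, r ^ n * (‖S (n + 1)‖ ^ 2 - ‖S n‖ ^ 2)) - r ^ N * ‖S N‖ ^ 2 ∧
      ‖(∑ n ∈ range N, (r : ℂ) ^ n * (S (n + 1) - S n)) - (r : ℂ) ^ N * S N‖ ^ 2 ≤
      (1 - r ^ N) *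
        ((∑ n ∈ range N, r ^ n * (‖S (n + 1)‖ ^ 2 - ‖S n‖ ^ 2)) - r ^ N * ‖S N‖ ^ 2) := by
    intro N
    induction N with
    | zero => simp [hS]
    | succ N ih =>
      have hw : 0 ≤ r ^ N - r ^ (N + 1) := sub_nonneg.2 (pow_le_pow_of_le_one h0 h1 (by simp))
      have := cauchy _ (S (N + 1)) _ _ _ (sub_nonneg.2 (pow_le_one₀ h0 h1)) hw ih.2 ih.1
      rw [sum_range_succ, sum_range_succ]
      constructor
      · nlinarith [ih.1, mul_nonneg hw (sq_nonneg ‖S (N + 1)‖)]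
      · convert this using 1
        · congr 2
          push_cast
          ring
        · ring
  have := cauchy _ (S N) _ _ _ (sub_nonneg.2 (pow_le_one₀ h0 h1)) (pow_nonneg h0 N)
    (key N).2 (key N).1
  convert this using 1
  · congr 2
    push_cast
    ring
  · ring

section MaximalInequality

variable {X ι : Type*}

/-- The function with coefficients `c` with respect to the system `E`. -/
def synthesis (E : ι → X → ℂ) (F : Finset ι) (c : ι → ℝ) (ξ : X) : ℂ :=
  ∑ x ∈ F, (c x : ℂ) * E x ξ

/-- The matrix entries of the multiplier `w` with respect to the system `E`. -/
def multiplierKernel [MeasurableSpace X] (μ : Measure X) (E : ι → X → ℂ) (w : X → ℝ) (x y : ι) : ℝ :=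
  ∫ ξ, w ξ * (E x ξ * (starRingEnd ℂ) (E y ξ)).re ∂μ

lemma continuous_synthesis [TopologicalSpace X] {E : ι → X → ℂ} (hE : ∀ x, Continuous (E x)) (F : Finset ι)
    (c : ι → ℝ) : Continuous (synthesis E F c) := by
  unfold synthesis
  fun_prop

lemma multiplierKernel_comm [MeasurableSpace X] (μ : Measure X) (E : ι → X → ℂ) (w : X → ℝ)
    (x y : ι) : multiplierKernel μ E w x y = multiplierKernel μ E w y x := by
  simp only [multiplierKernel]
  congr 1 with ξ
  simp only [Complex.mul_re, Complex.conj_re, Complex.conj_im]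
  ring

variable [TopologicalSpace X] [MeasurableSpace X]

lemma integral_mul_synthesis_mul_conj {μ : Measure X}
    (hμ : ∀ φ : X → ℝ, Continuous φ → Integrable φ μ) {E : ι → X → ℂ}
    (hE : ∀ x, Continuous (E x)) {w : X → ℝ} (hw : Continuous w) (F : Finset ι) (a b : ι → ℝ) :
    ∫ ξ, w ξ * (synthesis E F a ξ * (starRingEnd ℂ) (synthesis E F b ξ)).re ∂μ =
      ∑ x ∈ F, ∑ y ∈ F, a x * b y * multiplierKernel μ E w x y := by
  have hc : ∀ x y, Continuous fun ξ => w ξ * (E x ξ * (starRingEnd ℂ) (E y ξ)).re := fun x y =>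
    hw.mul (Complex.continuous_re.comp ((hE x).mul (Complex.continuous_conj.comp (hE y))))
  simp only [multiplierKernel, ← integral_const_mul]
  have h1 : ∀ x ∈ F, ∑ y ∈ F, ∫ ξ, a x * b y * (w ξ * (E x ξ * (starRingEnd ℂ) (E y ξ)).re) ∂μ =
      ∫ ξ, ∑ y ∈ F, a x * b y * (w ξ * (E x ξ * (starRingEnd ℂ) (E y ξ)).re) ∂μ := fun x _ =>
    (integral_finsetSum _ fun y _ => (hμ _ (hc x y)).const_mul _).symm
  rw [sum_congr rfl h1, ← integral_finsetSum _ fun x _ =>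
    integrable_finsetSum _ fun y _ => (hμ _ (hc x y)).const_mul _]
  congr 1 with ξ
  simp only [synthesis, map_sum]
  rw [sum_mul_sum]
  simp only [Complex.re_sum, mul_sum]
  refine sum_congr rfl fun x _ => sum_congr rfl fun y _ => ?_
  simp [Complex.mul_re, Complex.mul_im]
  ring

lemma integral_norm_sq_synthesis [DecidableEq ι] {μ : Measure X}
    (hμ : ∀ φ : X → ℝ, Continuous φ → Integrable φ μ) {E : ι → X → ℂ}
    (hE : ∀ x, Continuous (E x))
    (horth : ∀ x y, multiplierKernel μ E (fun _ => 1) x y = if x = y then 1 else 0)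
    (F : Finset ι) (a : ι → ℝ) :
    ∫ ξ, ‖synthesis E F a ξ‖ ^ 2 ∂μ = ∑ x ∈ F, a x ^ 2 := by
  have h := integral_mul_synthesis_mul_conj hμ hE (w := fun _ => 1) continuous_const F a a
  simp only [horth, mul_ite, mul_one, mul_zero, sum_ite_eq, one_mul, Complex.mul_conj,
    Complex.ofReal_re, Complex.normSq_eq_norm_sq] at h
  rw [h]
  exact sum_congr rfl fun x hx => by rw [if_pos hx, sq]

/-- The maximal inequality for the powers of a positive multiplier `w` with values in `[0, 1]`,
linearized by a choice `τ` of exponents. -/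
theorem sum_sq_multiplier_le [DecidableEq ι] {μ : Measure X}
    (hμ : ∀ φ : X → ℝ, Continuous φ → Integrable φ μ) {E : ι → X → ℂ}
    (hE : ∀ x, Continuous (E x))
    (horth : ∀ x y, multiplierKernel μ E (fun _ => 1) x y = if x = y then 1 else 0)
    {w : X → ℝ} (hw : Continuous w) (hw0 : ∀ ξ, 0 ≤ w ξ) (hw1 : ∀ ξ, w ξ ≤ 1)
    (hpos : ∀ n x y, 0 ≤ multiplierKernel μ E (fun ξ => w ξ ^ n) x y)
    (F : Finset ι) (f : ι → ℝ) (hf : ∀ x, 0 ≤ f x) (τ : ι → ℕ) :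
    ∑ x ∈ F, (∑ y ∈ F, multiplierKernel μ E (fun ξ => w ξ ^ τ x) x y * f y) ^ 2 ≤
      4 * ∑ x ∈ F, f x ^ 2 := by
  let K : ℕ → ι → ι → ℝ := fun n => multiplierKernel μ E fun ξ => w ξ ^ n
  obtain ⟨N, hN⟩ : ∃ N, ∀ x ∈ F, τ x < N :=
    ⟨F.sup τ + 1, fun x hx => Nat.lt_succ_of_le (le_sup hx)⟩
  let u : ι → ℝ := fun x => ∑ y ∈ F, K (τ x) x y * f y
  have hu : ∀ x, 0 ≤ u x := fun x => sum_nonneg fun y _ => mul_nonneg (hpos _ _ _) (hf y)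
  let g : ℕ → ι → ℝ := fun n x => if τ x = n then u x else 0
  let G : ℕ → ι → ℝ := fun n x => if τ x < n then u x else 0
  have hg : ∀ n x, 0 ≤ g n x := fun n x => by dsimp only [g]; split_ifs <;> simp [hu]
  have hG : ∀ n x, G n x ≤ u x := fun n x => by dsimp only [G]; split_ifs <;> simp [hu]
  have hGg : ∀ n x, G (n + 1) x = G n x + g n x := by
    intro n x
    dsimp only [G, g]
    split_ifs <;> first | omega | simp
  have hsumg : ∀ (φ : ℕ → ℝ), ∀ x ∈ F, ∑ n ∈ range N, g n x * φ n = u x * φ (τ x) := by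
    intro φ x hx
    simp [g, ite_mul, hN x hx]
  let S : ℕ → X → ℂ := fun n => synthesis E F (G n)
  let s : ℕ → X → ℂ := fun n => synthesis E F (g n)
  have hSs : ∀ n ξ, S (n + 1) ξ = S n ξ + s n ξ := by
    intro n ξ
    simp only [S, s, synthesis, hGg, ← sum_add_distrib]
    exact sum_congr rfl fun x _ => by push_cast; ring
  let h : X → ℂ := fun ξ => ∑ n ∈ range N, (w ξ : ℂ) ^ n * s n ξ
  have hsyn : ∀ c, Continuous (synthesis E F c) := continuous_synthesis hE F
  have hcs : ∀ n, Continuous (s n) := fun n => hsyn _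
  have hcS : ∀ n, Continuous (S n) := fun n => hsyn _
  have hch : Continuous h := by
    dsimp only [h]
    have := hcs
    fun_prop
  have hconj : ∀ {φ ψ : X → ℂ}, Continuous φ → Continuous ψ →
      Continuous fun ξ => (φ ξ * (starRingEnd ℂ) (ψ ξ)).re := fun hφ hψ =>
    Complex.continuous_re.comp (hφ.mul (Complex.continuous_conj.comp hψ))
  have hform : ∀ n a b, ∫ ξ, w ξ ^ n * (synthesis E F a ξ *
      (starRingEnd ℂ) (synthesis E F b ξ)).re ∂μ = ∑ x ∈ F, ∑ y ∈ F, a x * b y * K n x y :=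
    fun n a b => integral_mul_synthesis_mul_conj hμ hE (hw.pow n) F a b
  have hh : ∫ ξ, ‖h ξ‖ ^ 2 ∂μ ≤
      2 * ∑ n ∈ range N, ∑ x ∈ F, ∑ y ∈ F, u x * g n y * K n x y := by
    have h1 : ∀ n, ∫ ξ, w ξ ^ n * (‖S (n + 1) ξ‖ ^ 2 - ‖S n ξ‖ ^ 2) ∂μ ≤
        2 * ∑ x ∈ F, ∑ y ∈ F, u x * g n y * K n x y := by
      intro n
      have h2 : ∀ ξ, w ξ ^ n * (‖S (n + 1) ξ‖ ^ 2 - ‖S n ξ‖ ^ 2) =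
          w ξ ^ n * (synthesis E F (fun x => G (n + 1) x + G n x) ξ *
            (starRingEnd ℂ) (s n ξ)).re := by
        intro ξ
        have h3 : synthesis E F (fun x => G (n + 1) x + G n x) ξ = S (n + 1) ξ + S n ξ := by
          simp only [S, synthesis, ← sum_add_distrib]
          exact sum_congr rfl fun x _ => by push_cast; ring
        rw [h3, hSs, ← Complex.normSq_eq_norm_sq, ← Complex.normSq_eq_norm_sq]
        simp only [Complex.normSq_apply, Complex.add_re, Complex.add_im, Complex.mul_re,
          Complex.conj_re, Complex.conj_im]
        ring
      simp only [h2]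
      rw [hform n _ (g n), mul_sum]
      refine sum_le_sum fun x _ => ?_
      rw [mul_sum]
      refine sum_le_sum fun y _ => ?_
      have h4 : G (n + 1) x + G n x ≤ 2 * u x := by linarith [hG (n + 1) x, hG n x]
      nlinarith [mul_le_mul_of_nonneg_right h4 (mul_nonneg (hg n y) (hpos n x y))]
    have hi : ∀ n, Integrable (fun ξ => w ξ ^ n * (‖S (n + 1) ξ‖ ^ 2 - ‖S n ξ‖ ^ 2)) μ := by
      intro n
      apply hμ
      have := hcS
      fun_prop
    calc ∫ ξ, ‖h ξ‖ ^ 2 ∂μ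
        ≤ ∫ ξ, ∑ n ∈ range N, w ξ ^ n * (‖S (n + 1) ξ‖ ^ 2 - ‖S n ξ‖ ^ 2) ∂μ := by
          refine integral_mono (hμ _ (hch.norm.pow 2)) (integrable_finsetSum _ fun n _ => hi n)
            fun ξ => ?_
          have := norm_sq_sum_pow_mul_le (w ξ) (hw0 ξ) (hw1 ξ) (fun n => S n ξ)
            (by simp [S, G, synthesis]) N
          simpa [hSs, h] using this
      _ = ∑ n ∈ range N, ∫ ξ, w ξ ^ n * (‖S (n + 1) ξ‖ ^ 2 - ‖S n ξ‖ ^ 2) ∂μ :=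
          integral_finsetSum _ fun n _ => hi n
      _ ≤ _ := by
          rw [mul_sum]
          exact sum_le_sum fun n _ => h1 n
  have hint : ∀ φ : X → ℂ, Continuous φ → ∫ ξ, (φ ξ * (starRingEnd ℂ) (h ξ)).re ∂μ =
      ∑ n ∈ range N, ∫ ξ, w ξ ^ n * (φ ξ * (starRingEnd ℂ) (s n ξ)).re ∂μ := by
    intro φ hφ
    have hi : ∀ n, Integrable (fun ξ => w ξ ^ n * (φ ξ * (starRingEnd ℂ) (s n ξ)).re) μ :=
      fun n => hμ _ ((hw.pow n).mul (hconj hφ (hcs n)))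
    rw [← integral_finsetSum _ fun n _ => hi n]
    congr 1 with ξ
    simp only [h, map_sum, mul_sum, Complex.re_sum]
    refine sum_congr rfl fun n _ => ?_
    rw [← Complex.re_ofReal_mul, map_mul, map_pow, Complex.conj_ofReal]
    congr 1
    push_cast
    ring
  have hu2 : ∑ n ∈ range N, ∑ x ∈ F, ∑ y ∈ F, u x * g n y * K n x y =
      ∫ ξ, (synthesis E F u ξ * (starRingEnd ℂ) (h ξ)).re ∂μ := by
    rw [hint _ (hsyn u)]
    exact sum_congr rfl fun n _ => (hform n u (g n)).symm
  have hU : ∑ x ∈ F, u x ^ 2 = ∫ ξ, (synthesis E F f ξ * (starRingEnd ℂ) (h ξ)).re ∂μ := by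
    rw [hint _ (hsyn f)]
    have h1 : ∀ n, ∫ ξ, w ξ ^ n * (synthesis E F f ξ * (starRingEnd ℂ) (s n ξ)).re ∂μ =
        ∑ y ∈ F, g n y * ∑ x ∈ F, K n y x * f x := by
      intro n
      rw [hform n f (g n), sum_comm]
      refine sum_congr rfl fun y _ => ?_
      rw [mul_sum]
      exact sum_congr rfl fun x _ => by
        rw [show K n x y = K n y x from multiplierKernel_comm _ _ _ _ _]
        ring
    simp only [h1]
    rw [sum_comm]
    refine sum_congr rfl fun y hy => ?_
    rw [hsumg (fun n => ∑ x ∈ F, K n y x * f x) y hy, sq]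
  have hre : ∀ (c : ℝ), 0 < c → ∀ z v : ℂ, (z * (starRingEnd ℂ) v).re ≤
      c * ‖z‖ ^ 2 + (4 * c)⁻¹ * ‖v‖ ^ 2 := by
    intro c hc z v
    have h1 : (z * (starRingEnd ℂ) v).re ≤ ‖z‖ * ‖v‖ := by
      simpa using Complex.re_le_norm (z * (starRingEnd ℂ) v)
    have h2 : c * ‖z‖ ^ 2 + (4 * c)⁻¹ * ‖v‖ ^ 2 - ‖z‖ * ‖v‖ =
        c * (‖z‖ - (2 * c)⁻¹ * ‖v‖) ^ 2 := by
      field_simp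
      ring
    nlinarith [mul_nonneg hc.le (sq_nonneg (‖z‖ - (2 * c)⁻¹ * ‖v‖))]
  have hcs' : ∀ (c : ℝ), 0 < c → ∀ a, ∫ ξ, (synthesis E F a ξ * (starRingEnd ℂ) (h ξ)).re ∂μ ≤
      c * ∑ x ∈ F, a x ^ 2 + (4 * c)⁻¹ * ∫ ξ, ‖h ξ‖ ^ 2 ∂μ := by
    intro c hc a
    have hia : Integrable (fun ξ => c * ‖synthesis E F a ξ‖ ^ 2) μ :=
      (hμ _ ((hsyn a).norm.pow 2)).const_mul c
    have hih : Integrable (fun ξ => (4 * c)⁻¹ * ‖h ξ‖ ^ 2) μ :=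
      (hμ _ (hch.norm.pow 2)).const_mul (4 * c)⁻¹
    rw [← integral_norm_sq_synthesis hμ hE horth, ← integral_const_mul, ← integral_const_mul,
      ← integral_add hia hih]
    exact integral_mono (hμ _ (hconj (hsyn a) hch)) (hia.add hih) fun ξ => hre c hc _ _
  have e1 := hcs' 1 one_pos u
  have e2 := hcs' 2 two_pos f
  rw [hu2] at hh
  rw [← hU] at e2
  change ∑ x ∈ F, u x ^ 2 ≤ _
  linarith

end MaximalInequality

section Torus

/-- The cube `[-1/2, 1/2]^d` with Lebesgue measure. -/
def cubeMeasure (d : ℕ) : Measure (Fin d → ℝ) :=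
  volume.restrict (Set.Icc (fun _ => (-(1 / 2) : ℝ)) (fun _ => ((1 / 2) : ℝ)))

/-- The character `e(x·(ξ + (1/2, …, 1/2)))`. -/
def shiftedChar (d : ℕ) (x : Fin d → ℤ) (ξ : Fin d → ℝ) : ℂ :=
  Complex.exp (2 * (Real.pi : ℂ) * Complex.I * ∑ k, (x k : ℂ) * ((ξ k : ℂ) + 1 / 2))

/-- The multiplier `exp(-(1/d) Σ cos²(π ξ_i))`. -/
def cosMultiplier (d : ℕ) (ξ : Fin d → ℝ) : ℝ :=
  Real.exp (-((1 : ℝ) / d) * ∑ i, Real.cos (Real.pi * ξ i) ^ 2)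

variable {d : ℕ}

lemma integrable_cubeMeasure {V : Type*} [NormedAddCommGroup V] {φ : (Fin d → ℝ) → V}
    (hφ : Continuous φ) : Integrable φ (cubeMeasure d) :=
  hφ.integrableOn_Icc

instance : IsFiniteMeasure (cubeMeasure d) :=
  ⟨by simpa [cubeMeasure] using isCompact_Icc.measure_lt_top⟩

lemma continuous_shiftedChar (x : Fin d → ℤ) : Continuous (shiftedChar d x) := by
  unfold shiftedChar
  fun_prop

lemma continuous_cosMultiplier : Continuous (cosMultiplier d) := by
  unfold cosMultiplier
  fun_prop

lemma cosMultiplier_nonneg (ξ : Fin d → ℝ) : 0 ≤ cosMultiplier d ξ := (Real.exp_pos _).le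

lemma cosMultiplier_le_one (ξ : Fin d → ℝ) : cosMultiplier d ξ ≤ 1 := by
  refine Real.exp_le_one_iff.2 ?_
  rw [neg_mul]
  exact neg_nonpos.2 (by positivity)

lemma shiftedChar_add (x y : Fin d → ℤ) (ξ : Fin d → ℝ) :
    shiftedChar d (x + y) ξ = shiftedChar d x ξ * shiftedChar d y ξ := by
  simp only [shiftedChar, ← Complex.exp_add, ← mul_add, ← sum_add_distrib, Pi.add_apply]
  congr 2
  exact sum_congr rfl fun k _ => by push_cast; ring

lemma conj_shiftedChar (x : Fin d → ℤ) (ξ : Fin d → ℝ) :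
    (starRingEnd ℂ) (shiftedChar d x ξ) = shiftedChar d (-x) ξ := by
  simp only [shiftedChar, ← Complex.exp_conj, map_mul, map_sum, map_add, map_div₀, map_one,
    Complex.conj_ofReal, Complex.conj_I, map_intCast, map_ofNat, Pi.neg_apply, Int.cast_neg,
    neg_mul, sum_neg_distrib, mul_neg]

lemma shiftedChar_mul_conj (x y : Fin d → ℤ) (ξ : Fin d → ℝ) :
    shiftedChar d x ξ * (starRingEnd ℂ) (shiftedChar d y ξ) = shiftedChar d (x - y) ξ := by
  rw [conj_shiftedChar, ← shiftedChar_add, sub_eq_add_neg]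

lemma norm_shiftedChar (x : Fin d → ℤ) (ξ : Fin d → ℝ) : ‖shiftedChar d x ξ‖ = 1 := by
  have h := shiftedChar_mul_conj x x ξ
  rw [Complex.mul_conj, sub_self, Complex.normSq_eq_norm_sq] at h
  have h1 : ‖shiftedChar d x ξ‖ ^ 2 = 1 := by
    have h2 : shiftedChar d 0 ξ = 1 := by simp [shiftedChar]
    rw [h2] at h
    exact_mod_cast h
  exact (pow_eq_one_iff_of_nonneg (norm_nonneg _) two_ne_zero).1 h1

lemma integral_exp_shifted (n : ℤ) :
    ∫ t in Set.Icc (-(1 / 2) : ℝ) (1 / 2),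
      Complex.exp (2 * (Real.pi : ℂ) * Complex.I * ((n : ℂ) * ((t : ℂ) + 1 / 2))) =
      if n = 0 then 1 else 0 := by
  rw [integral_Icc_eq_integral_Ioc, ← intervalIntegral.integral_of_le (by norm_num)]
  split_ifs with hn
  · subst hn
    norm_num
  · have hc : 2 * (Real.pi : ℂ) * Complex.I * n ≠ 0 := by
      simp [Real.pi_ne_zero, hn]
    have h := integral_exp_mul_complex (a := 0) (b := 1) hc
    have h2 := intervalIntegral.integral_comp_add_right (a := -(1 / 2)) (b := 1 / 2)
      (fun t : ℝ => Complex.exp (2 * (Real.pi : ℂ) * Complex.I * n * t)) (1 / 2)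
    norm_num at h2
    have h3 : Complex.exp (2 * Real.pi * Complex.I * n) = 1 := by
      rw [mul_comm]
      exact Complex.exp_int_mul_two_pi_mul_I n
    rw [h] at h2
    simp only [Complex.ofReal_one, mul_one, Complex.ofReal_zero, mul_zero, Complex.exp_zero, h3,
      sub_self, zero_div] at h2
    rw [← h2]
    norm_num [mul_assoc]

lemma integral_shiftedChar (z : Fin d → ℤ) :
    ∫ ξ, shiftedChar d z ξ ∂(cubeMeasure d) = if z = 0 then 1 else 0 := by
  have h : cubeMeasure d =
      Measure.pi fun _ : Fin d => (volume : Measure ℝ).restrict (Set.Icc (-(1 / 2)) (1 / 2)) := by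
    rw [cubeMeasure, ← Set.pi_univ_Icc, volume_pi, Measure.restrict_pi_pi]
  simp only [shiftedChar, mul_sum, Complex.exp_sum, h]
  rw [integral_fintype_prod_eq_prod (fun k (t : ℝ) =>
    Complex.exp (2 * (Real.pi : ℂ) * Complex.I * ((z k : ℂ) * ((t : ℂ) + 1 / 2))))]
  simp only [integral_exp_shifted, prod_ite_zero, prod_const_one, mem_univ, true_implies,
    funext_iff, Pi.zero_apply]

/-- The sum of the characters at the `2d` nearest neighbours of the origin. -/
def neighborSum (d : ℕ) (ξ : Fin d → ℝ) : ℂ :=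
  ∑ i, (shiftedChar d (Pi.single i 1) ξ + shiftedChar d (-Pi.single i 1) ξ)

lemma continuous_neighborSum : Continuous (neighborSum d) := by
  have := continuous_shiftedChar (d := d)
  unfold neighborSum
  fun_prop

lemma norm_neighborSum_le (ξ : Fin d → ℝ) : ‖neighborSum d ξ‖ ≤ 2 * d := by
  refine (norm_sum_le_of_le (f := fun i => _) univ (n := fun _ => (2 : ℝ)) fun i _ => ?_).trans
    (by simp [mul_comm])
  refine (norm_add_le _ _).trans ?_
  rw [norm_shiftedChar, norm_shiftedChar]
  norm_num

open scoped ComplexOrder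

lemma integral_neighborSum_pow_nonneg (n : ℕ) (z : Fin d → ℤ) :
    0 ≤ ∫ ξ, neighborSum d ξ ^ n * shiftedChar d z ξ ∂(cubeMeasure d) := by
  induction n generalizing z with
  | zero =>
    simp only [pow_zero, one_mul, integral_shiftedChar]
    split_ifs <;> simp
  | succ n ih =>
    have h : ∀ ξ, neighborSum d ξ ^ (n + 1) * shiftedChar d z ξ =
        ∑ i, (neighborSum d ξ ^ n * shiftedChar d (Pi.single i 1 + z) ξ +
          neighborSum d ξ ^ n * shiftedChar d (-Pi.single i 1 + z) ξ) := by
      intro ξ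
      rw [pow_succ, mul_assoc]
      conv_lhs => enter [2, 1]; rw [neighborSum]
      rw [sum_mul, mul_sum]
      refine sum_congr rfl fun i _ => ?_
      rw [shiftedChar_add, shiftedChar_add]
      ring
    have hi : ∀ y, Integrable (fun ξ => neighborSum d ξ ^ n * shiftedChar d y ξ)
        (cubeMeasure d) := fun y =>
      integrable_cubeMeasure ((continuous_neighborSum.pow n).mul (continuous_shiftedChar y))
    simp only [h]
    rw [integral_finsetSum]
    swap
    · exact fun i _ => (hi _).add (hi _)
    refine sum_nonneg fun i _ => ?_
    rw [integral_add (hi _) (hi _)]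
    exact add_nonneg (ih _) (ih _)

lemma integral_exp_neighborSum_nonneg (s : ℝ) (hs : 0 ≤ s) (z : Fin d → ℤ) :
    0 ≤ ∫ ξ, Complex.exp (s * neighborSum d ξ) * shiftedChar d z ξ ∂(cubeMeasure d) := by
  let F : ℕ → (Fin d → ℝ) → ℂ := fun n ξ =>
    ((s ^ n / n.factorial : ℝ) : ℂ) * (neighborSum d ξ ^ n * shiftedChar d z ξ)
  have hc : ∀ n, Continuous (F n) := fun n => continuous_const.mul
    ((continuous_neighborSum.pow n).mul (continuous_shiftedChar z))
  have hF : ∀ n, Integrable (F n) (cubeMeasure d) := fun n => integrable_cubeMeasure (hc n)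
  have hle : ∀ n ξ, ‖F n ξ‖ ≤ (s * (2 * d)) ^ n / n.factorial := by
    intro n ξ
    simp only [F, norm_mul, norm_pow, norm_shiftedChar, mul_one, Complex.norm_real]
    rw [Real.norm_of_nonneg (by positivity), mul_pow, div_mul_eq_mul_div]
    gcongr
    exact norm_neighborSum_le ξ
  have hsum : Summable fun n => ∫ ξ, ‖F n ξ‖ ∂(cubeMeasure d) := by
    refine Summable.of_nonneg_of_le (fun n => integral_nonneg fun ξ => norm_nonneg _)
      (fun n => integral_mono (hF n).norm (integrable_const _) (hle n)) ?_
    simp only [integral_const, smul_eq_mul]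
    exact (Real.summable_pow_div_factorial _).mul_left _
  have h := hasSum_integral_of_summable_integral_norm hF hsum
  have hexp : ∀ ξ, ∑' n, F n ξ = Complex.exp (s * neighborSum d ξ) * shiftedChar d z ξ := by
    intro ξ
    rw [Complex.exp_eq_exp_ℂ, NormedSpace.exp_eq_tsum_div, ← tsum_mul_right]
    refine tsum_congr fun n => ?_
    simp only [F]
    push_cast
    ring
  simp only [hexp] at h
  refine h.nonneg fun n => ?_
  simp only [F, integral_const_mul]
  exact mul_nonneg (Complex.zero_le_real.2 (by positivity)) (integral_neighborSum_pow_nonneg n z)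

lemma cosMultiplier_pow (hd : d ≠ 0) (n : ℕ) (ξ : Fin d → ℝ) :
    ((cosMultiplier d ξ ^ n : ℝ) : ℂ) = ((Real.exp (-(n / 2)) : ℝ) : ℂ) *
      Complex.exp (((n / (4 * d) : ℝ) : ℂ) * neighborSum d ξ) := by
  have hcos : ∀ i, shiftedChar d (Pi.single i 1) ξ + shiftedChar d (-Pi.single i 1) ξ =
      2 - 4 * (Real.cos (Real.pi * ξ i) : ℂ) ^ 2 := by
    intro i
    have h1 : shiftedChar d (Pi.single i 1) ξ =
        -Complex.exp (2 * (Real.pi * ξ i : ℂ) * Complex.I) := by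
      have h2 : ∑ k, ((Pi.single i (1 : ℤ) : Fin d → ℤ) k : ℂ) * ((ξ k : ℂ) + 1 / 2) =
          ξ i + 1 / 2 := by
        rw [sum_eq_single i]
        · simp
        · intro k _ hk
          simp [hk]
        · simp
      rw [shiftedChar, h2, ← mul_neg_one, ← Complex.exp_pi_mul_I, ← Complex.exp_add]
      congr 1
      ring
    have h3 : shiftedChar d (-Pi.single i 1) ξ =
        -Complex.exp (-(2 * (Real.pi * ξ i : ℂ)) * Complex.I) := by
      rw [← conj_shiftedChar, h1, map_neg, ← Complex.exp_conj]
      simp only [map_mul, map_ofNat, Complex.conj_ofReal, Complex.conj_I, mul_neg, neg_mul]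
    have h4 := Complex.two_cos (x := 2 * (Real.pi * ξ i : ℂ))
    rw [Complex.cos_two_mul] at h4
    rw [h1, h3]
    push_cast
    linear_combination h4
  have hd' : (d : ℂ) ≠ 0 := Nat.cast_ne_zero.2 hd
  rw [cosMultiplier, ← Real.exp_nat_mul, Complex.ofReal_exp, Complex.ofReal_exp,
    ← Complex.exp_add, neighborSum, sum_congr rfl fun i _ => hcos i, sum_sub_distrib, ← mul_sum]
  congr 1
  simp only [sum_const, card_univ, Fintype.card_fin, nsmul_eq_mul]
  push_cast
  field_simp
  ring

lemma integral_cosMultiplier_pow_nonneg (hd : d ≠ 0) (n : ℕ) (z : Fin d → ℤ) :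
    0 ≤ ∫ ξ, ((cosMultiplier d ξ ^ n : ℝ) : ℂ) * shiftedChar d z ξ ∂(cubeMeasure d) := by
  simp only [cosMultiplier_pow hd, mul_assoc, integral_const_mul]
  exact mul_nonneg (Complex.zero_le_real.2 (by positivity))
    (integral_exp_neighborSum_nonneg _ (by positivity) z)

lemma multiplierKernel_shiftedChar {w : (Fin d → ℝ) → ℝ} (hw : Continuous w)
    (x y : Fin d → ℤ) : multiplierKernel (cubeMeasure d) (shiftedChar d) w x y =
      (∫ ξ, (w ξ : ℂ) * shiftedChar d (x - y) ξ ∂(cubeMeasure d)).re := by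
  have hi : Integrable (fun ξ => (w ξ : ℂ) * shiftedChar d (x - y) ξ) (cubeMeasure d) :=
    integrable_cubeMeasure ((Complex.continuous_ofReal.comp hw).mul (continuous_shiftedChar _))
  simp only [multiplierKernel, shiftedChar_mul_conj, ← Complex.re_ofReal_mul]
  exact integral_re hi

lemma multiplierKernel_cosMultiplier (hd : d ≠ 0) (n : ℕ) (x y : Fin d → ℤ) :
    multiplierKernel (cubeMeasure d) (shiftedChar d) (fun ξ => cosMultiplier d ξ ^ n) x y =
      ‖∫ ξ, ((cosMultiplier d ξ ^ n : ℝ) : ℂ) * shiftedChar d (x - y) ξ ∂(cubeMeasure d)‖ := by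
  rw [multiplierKernel_shiftedChar (w := fun ξ => cosMultiplier d ξ ^ n)
    (continuous_cosMultiplier.pow n)]
  exact Complex.re_eq_norm.2 (integral_cosMultiplier_pow_nonneg hd n _)

lemma abs_sphereS_sign_average_le_one (d t : ℕ) :
    |((sphereS d t).card : ℝ)⁻¹ * ∑ x ∈ sphereS d t, (-1 : ℝ) ^ (∑ i, x i)| ≤ 1 := by
  rw [abs_mul, abs_inv, Nat.abs_cast]
  refine inv_mul_le_one_of_le₀ ?_ (Nat.cast_nonneg _)
  refine (abs_sum_le_sum_abs _ _).trans ?_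
  simp [abs_zpow]

lemma norm_finv_lam2_le (hd : d ≠ 0) (t : ℕ) (f : (Fin d → ℤ) → ℂ) (F : Finset (Fin d → ℤ))
    (hf : Function.support f ⊆ F) (x : Fin d → ℤ) :
    ‖finv d (fun ξ => (lam2 d t ξ : ℂ) * ftrans d f ξ) x‖ ≤
      ∑ y ∈ F, multiplierKernel (cubeMeasure d) (shiftedChar d)
        (fun ξ => cosMultiplier d ξ ^ t) x y * ‖f y‖ := by
  set c : ℝ := ((sphereS d t).card : ℝ)⁻¹ * ∑ x ∈ sphereS d t, (-1 : ℝ) ^ (∑ i, x i)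
  let σ : (Fin d → ℤ) → ℂ := fun y =>
    Complex.exp (((Real.pi * ∑ k, ((x k : ℝ) - y k) : ℝ) : ℂ) * Complex.I)
  have hσ : ∀ y, ‖σ y‖ = 1 := fun y => Complex.norm_exp_ofReal_mul_I _
  have hlam : ∀ ξ, lam2 d t ξ = c * cosMultiplier d ξ ^ t := by
    intro ξ
    rw [lam2, cosMultiplier, ← Real.exp_nat_mul]
    congr 2
    ring
  have hft : ∀ ξ, ftrans d f ξ = ∑ y ∈ F, f y *
      Complex.exp (2 * (Real.pi : ℂ) * Complex.I * ∑ k, (y k : ℂ) * (ξ k : ℂ)) := by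
    intro ξ
    refine finsum_eq_sum_of_support_subset _ fun y hy => hf ?_
    exact left_ne_zero_of_mul hy
  have hexp : ∀ y (ξ : Fin d → ℝ),
      Complex.exp (2 * (Real.pi : ℂ) * Complex.I * ∑ k, (y k : ℂ) * (ξ k : ℂ)) *
        Complex.exp (-(2 * (Real.pi : ℂ) * Complex.I * ∑ k, (x k : ℂ) * (ξ k : ℂ))) =
      σ y * shiftedChar d (y - x) ξ := by
    intro y ξ
    simp only [σ, shiftedChar, ← Complex.exp_add]
    congr 1
    push_cast
    simp only [mul_sum, sum_mul, ← sum_neg_distrib, ← sum_add_distrib]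
    refine sum_congr rfl fun k _ => ?_
    simp only [Pi.sub_apply]
    push_cast
    ring
  have hint : ∀ ξ, (lam2 d t ξ : ℂ) * ftrans d f ξ *
      Complex.exp (-(2 * (Real.pi : ℂ) * Complex.I * ∑ k, (x k : ℂ) * (ξ k : ℂ))) =
      ∑ y ∈ F, (c * f y * σ y) *
        (((cosMultiplier d ξ ^ t : ℝ) : ℂ) * shiftedChar d (y - x) ξ) := by
    intro ξ
    rw [hlam, hft, mul_sum, sum_mul]
    refine sum_congr rfl fun y _ => ?_
    have := hexp y ξ
    push_cast
    linear_combination (c * (cosMultiplier d ξ : ℂ) ^ t * f y) * this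
  have hi : ∀ y, Integrable (fun ξ => (c * f y * σ y) *
      (((cosMultiplier d ξ ^ t : ℝ) : ℂ) * shiftedChar d (y - x) ξ)) (cubeMeasure d) := fun y =>
    integrable_cubeMeasure (continuous_const.mul
      ((Complex.continuous_ofReal.comp (continuous_cosMultiplier.pow t)).mul
        (continuous_shiftedChar _)))
  rw [finv]
  simp only [hint]
  change ‖∫ ξ, _ ∂(cubeMeasure d)‖ ≤ _
  rw [integral_finsetSum _ fun y _ => hi y]
  refine norm_sum_le_of_le _ fun y _ => ?_
  rw [integral_const_mul, norm_mul, norm_mul, norm_mul, hσ, mul_one, multiplierKernel_comm,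
    multiplierKernel_cosMultiplier hd, Complex.norm_real, mul_comm]
  refine mul_le_mul_of_nonneg_left ?_ (norm_nonneg _)
  exact mul_le_of_le_one_left (norm_nonneg _) (abs_sphereS_sign_average_le_one d t)

end Torus

/-- Corollary 4.3: for finitely supported `f : ℤ^d → ℂ`,
`‖ sup_{t ∈ ℕ, 1 ≤ t ≤ d} |𝓕⁻¹(λ_t² f̂)| ‖_{l²(ℤ^d)} ≤ 2 ‖f‖_{l²(ℤ^d)}`. -/
theorem maximal_semigroup_lam2_l2_bound (d : ℕ) (hd : 1 ≤ d)
    (f : (Fin d → ℤ) → ℂ) (hf : (Function.support f).Finite) :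
    (∑' x : Fin d → ℤ,
        (⨆ (t : ℕ) (_ : 1 ≤ t) (_ : t ≤ d),
          (‖finv d (fun ξ => (lam2 d t ξ : ℂ) * ftrans d f ξ) x‖₊ : ℝ≥0∞)) ^ (2 : ℝ)) ^ ((1 : ℝ) / 2)
      ≤ 2 * (∑' x : Fin d → ℤ, (‖f x‖₊ : ℝ≥0∞) ^ (2 : ℝ)) ^ ((1 : ℝ) / 2) := by
  have hd0 : d ≠ 0 := by omega
  let k : ℕ → (Fin d → ℤ) → (Fin d → ℤ) → ℝ := fun t =>
    multiplierKernel (cubeMeasure d) (shiftedChar d) fun ξ => cosMultiplier d ξ ^ t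
  let a : ℕ → (Fin d → ℤ) → ℝ≥0∞ := fun t x =>
    (‖finv d (fun ξ => (lam2 d t ξ : ℂ) * ftrans d f ξ) x‖₊ : ℝ≥0∞)
  have hτ : ∀ x, ∃ t, ∀ s, 1 ≤ s → s ≤ d → a s x ≤ a t x := by
    intro x
    obtain ⟨t, -, ht⟩ := exists_max_image (Finset.Icc 1 d) (fun t => a t x)
      ⟨1, mem_Icc.2 ⟨le_rfl, hd⟩⟩
    exact ⟨t, fun s h1 h2 => ht s (mem_Icc.2 ⟨h1, h2⟩)⟩
  choose τ hτ using hτ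
  have horth : ∀ x y, multiplierKernel (cubeMeasure d) (shiftedChar d) (fun _ => 1) x y =
      if x = y then 1 else 0 := by
    intro x y
    rw [multiplierKernel_shiftedChar continuous_const]
    simp only [Complex.ofReal_one, one_mul, integral_shiftedChar, sub_eq_zero]
    split_ifs <;> simp
  have hmain : ∑' x, (⨆ (t : ℕ) (_ : 1 ≤ t) (_ : t ≤ d), a t x) ^ (2 : ℝ) ≤
      4 * ∑' x, (‖f x‖₊ : ℝ≥0∞) ^ (2 : ℝ) := by
    rw [ENNReal.tsum_eq_iSup_sum]
    refine iSup_le fun F₀ => ?_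
    let F : Finset (Fin d → ℤ) := F₀ ∪ hf.toFinset
    have hfF : Function.support f ⊆ F := fun x hx => by simp [F, Function.mem_support.1 hx]
    have hreal := sum_sq_multiplier_le (fun _ hφ => integrable_cubeMeasure hφ)
      continuous_shiftedChar horth continuous_cosMultiplier cosMultiplier_nonneg
      cosMultiplier_le_one
      (fun n x y => (multiplierKernel_cosMultiplier hd0 n x y).symm ▸ norm_nonneg _) F
      (fun x => ‖f x‖) (fun _ => norm_nonneg _) τ
    calc ∑ x ∈ F₀, (⨆ (t : ℕ) (_ : 1 ≤ t) (_ : t ≤ d), a t x) ^ (2 : ℝ)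
        ≤ ∑ x ∈ F, (⨆ (t : ℕ) (_ : 1 ≤ t) (_ : t ≤ d), a t x) ^ (2 : ℝ) :=
          sum_le_sum_of_subset subset_union_left
      _ ≤ ∑ x ∈ F, ENNReal.ofReal ((∑ y ∈ F, k (τ x) x y * ‖f y‖) ^ 2) := by
          refine sum_le_sum fun x _ => ?_
          rw [ENNReal.rpow_two, ENNReal.ofReal_pow
            (le_trans (norm_nonneg _) (norm_finv_lam2_le hd0 (τ x) f F hfF x))]
          gcongr
          refine (iSup_le fun t => iSup_le fun h1 => iSup_le fun h2 => hτ x t h1 h2).trans ?_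
          refine (ofReal_norm _).ge.trans ?_
          exact ENNReal.ofReal_le_ofReal (norm_finv_lam2_le hd0 (τ x) f F hfF x)
      _ = ENNReal.ofReal (∑ x ∈ F, (∑ y ∈ F, k (τ x) x y * ‖f y‖) ^ 2) :=
          (ENNReal.ofReal_sum_of_nonneg fun _ _ => sq_nonneg _).symm
      _ ≤ ENNReal.ofReal (4 * ∑ x ∈ F, ‖f x‖ ^ 2) := ENNReal.ofReal_le_ofReal hreal
      _ = 4 * ∑ x ∈ F, (‖f x‖₊ : ℝ≥0∞) ^ (2 : ℝ) := by
          rw [ENNReal.ofReal_mul (by norm_num), ENNReal.ofReal_sum_of_nonneg fun _ _ => sq_nonneg _]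
          congr 1
          · norm_num
          · refine sum_congr rfl fun x _ => ?_
            rw [ENNReal.rpow_two, ENNReal.ofReal_pow (norm_nonneg _), ofReal_norm]
            rfl
      _ ≤ _ := by gcongr; exact ENNReal.sum_le_tsum F
  calc _ ≤ (4 * ∑' x, (‖f x‖₊ : ℝ≥0∞) ^ (2 : ℝ)) ^ ((1 : ℝ) / 2) :=
        ENNReal.rpow_le_rpow hmain (by norm_num)
    _ = _ := by
        rw [ENNReal.mul_rpow_of_nonneg _ _ (by norm_num)]
        congr 1
        rw [show (4 : ℝ≥0∞) = 2 ^ (2 : ℝ) by norm_num, ← ENNReal.rpow_mul]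
        norm_num
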